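/- arXiv:2402.15416 — 2 statements merged into one kernel-verified Lean document; each statement's English description precedes it below -/
import Mathlib

section
/- For all m, n ≥ 1, LE_CN(K_{m+n}) ≥ LE_CN(K_{m,n}), with equality if and only if m = n = 1. In particular, the complete bipartite graph K_{m,n} is not CNL-hyperenergetic. -/
set_option linter.unusedSectionVars false

open Matrix BigOperators Finset

namespace CNE

variable {V : Type*} [Fintype V]

/-- The common neighborhood matrix `CN(G)`. -/
noncomputable def cn [DecidableEq V] (G : SimpleGraph V) : Matrix V V ℝ :=
  Matrix.of fun i j => if i = j then 0 else (Nat.card (G.commonNeighbors i j) : ℝ)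

/-- The common neighborhood row sum (diagonal) matrix `CNRS(G)`. -/
noncomputable def cnrs [DecidableEq V] (G : SimpleGraph V) : Matrix V V ℝ :=
  Matrix.diagonal fun i => ∑ j, cn G i j

/-- The common neighborhood Laplacian matrix `CNL(G) = CNRS(G) - CN(G)`. -/
noncomputable def cnl [DecidableEq V] (G : SimpleGraph V) : Matrix V V ℝ :=
  cnrs G - cn G

/-- The common neighborhood signless Laplacian matrix `CNSL(G) = CNRS(G) + CN(G)`. -/
noncomputable def cnsl [DecidableEq V] (G : SimpleGraph V) : Matrix V V ℝ :=
  cnrs G + cn G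

lemma cn_isHermitian [DecidableEq V] (G : SimpleGraph V) : (cn G).IsHermitian := by
  ext i j
  simp only [Matrix.conjTranspose_apply, cn, Matrix.of_apply, star_trivial]
  rw [SimpleGraph.commonNeighbors_symm]
  by_cases h : i = j
  · simp [h]
  · rw [if_neg h, if_neg fun hji => h hji.symm]

lemma cnrs_isHermitian [DecidableEq V] (G : SimpleGraph V) : (cnrs G).IsHermitian :=
  Matrix.isHermitian_diagonal _

lemma cnl_isHermitian [DecidableEq V] (G : SimpleGraph V) : (cnl G).IsHermitian :=
  (cnrs_isHermitian G).sub (cn_isHermitian G)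

lemma cnsl_isHermitian [DecidableEq V] (G : SimpleGraph V) : (cnsl G).IsHermitian :=
  (cnrs_isHermitian G).add (cn_isHermitian G)

/-- The common neighborhood energy `E_CN(G)`: the sum of the absolute values of the
eigenvalues (with multiplicity) of `CN(G)`. -/
noncomputable def Ecn [DecidableEq V] (G : SimpleGraph V) : ℝ :=
  ∑ i, |(cn_isHermitian G).eigenvalues i|

/-- The common neighborhood Laplacian energy `LE_CN(G)`. -/
noncomputable def LEcn [DecidableEq V] (G : SimpleGraph V) : ℝ :=
  ∑ i, |(cnl_isHermitian G).eigenvalues i - (cnrs G).trace / (Fintype.card V : ℝ)|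

/-- The common neighborhood signless Laplacian energy `LE⁺_CN(G)`. -/
noncomputable def LEpcn [DecidableEq V] (G : SimpleGraph V) : ℝ :=
  ∑ i, |(cnsl_isHermitian G).eigenvalues i - (cnrs G).trace / (Fintype.card V : ℝ)|

open Classical in
/-- The (real) adjacency matrix of a graph, defined classically. -/
noncomputable def adjMat (G : SimpleGraph V) : Matrix V V ℝ :=
  Matrix.of fun i j => if G.Adj i j then 1 else 0

lemma adjMat_isHermitian (G : SimpleGraph V) : (adjMat G).IsHermitian := by
  ext i j
  simp only [Matrix.conjTranspose_apply, adjMat, Matrix.of_apply, star_trivial]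
  by_cases h : G.Adj i j
  · simp [h, h.symm]
  · have h' : ¬ G.Adj j i := fun hji => h hji.symm
    simp [h, h']

/-- The diagonal degree matrix of a graph. -/
noncomputable def degMat [DecidableEq V] (G : SimpleGraph V) : Matrix V V ℝ :=
  Matrix.diagonal fun v => (Nat.card (G.neighborSet v) : ℝ)

/-- The Laplacian matrix `L(G) = D(G) - A(G)`. -/
noncomputable def lap [DecidableEq V] (G : SimpleGraph V) : Matrix V V ℝ :=
  degMat G - adjMat G

/-- The signless Laplacian matrix `Q(G) = D(G) + A(G)`. -/
noncomputable def slap [DecidableEq V] (G : SimpleGraph V) : Matrix V V ℝ :=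
  degMat G + adjMat G

lemma degMat_isHermitian [DecidableEq V] (G : SimpleGraph V) : (degMat G).IsHermitian :=
  Matrix.isHermitian_diagonal _

lemma lap_isHermitian [DecidableEq V] (G : SimpleGraph V) : (lap G).IsHermitian :=
  (degMat_isHermitian G).sub (adjMat_isHermitian G)

lemma slap_isHermitian [DecidableEq V] (G : SimpleGraph V) : (slap G).IsHermitian :=
  (degMat_isHermitian G).add (adjMat_isHermitian G)

/-- The energy `E(G)` of a graph: the sum of the absolute values of the eigenvalues
(with multiplicity) of the adjacency matrix. -/
noncomputable def energy [DecidableEq V] (G : SimpleGraph V) : ℝ :=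
  ∑ i, |(adjMat_isHermitian G).eigenvalues i|

/-- The Laplacian energy `LE(G)`. -/
noncomputable def LE [DecidableEq V] (G : SimpleGraph V) : ℝ :=
  ∑ i, |(lap_isHermitian G).eigenvalues i - (degMat G).trace / (Fintype.card V : ℝ)|

/-- The signless Laplacian energy `LE⁺(G)`. -/
noncomputable def LEp [DecidableEq V] (G : SimpleGraph V) : ℝ :=
  ∑ i, |(slap_isHermitian G).eigenvalues i - (degMat G).trace / (Fintype.card V : ℝ)|

/-- The derived graph `G†`: two vertices are adjacent iff their distance in `G` is two. -/
def derivedGraph (G : SimpleGraph V) : SimpleGraph V where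
  Adj u v := G.dist u v = 2
  symm := by
    constructor
    intro u v h
    rwa [SimpleGraph.dist_comm]
  loopless := by
    constructor
    intro v h
    simp [SimpleGraph.dist_self] at h

lemma LE_aux [DecidableEq V] (G : SimpleGraph V) (c a : ℝ)
    (hc : cnl G * cnl G = c • cnl G) (ha0 : 0 ≤ a) (hac : a ≤ c)
    (ha : (cnrs G).trace / (Fintype.card V : ℝ) = a) :
    LEcn G = Fintype.card V * a + (cnrs G).trace * ((c - 2 * a) / c) := by
  have ht : (cnrs G).trace = ∑ i, (cnl_isHermitian G).eigenvalues i := by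
    have h := (cnl_isHermitian G).trace_eq_sum_eigenvalues
    have h2 : (cnl G).trace = (cnrs G).trace := by
      rw [cnl, Matrix.trace_sub]
      simp [Matrix.trace, cn]
    rw [← h2, h]; simp
  have key : ∀ i, |(cnl_isHermitian G).eigenvalues i - a|
      = a + (cnl_isHermitian G).eigenvalues i * ((c - 2 * a) / c) := by
    intro i
    set x := (cnl_isHermitian G).eigenvalues i with hx
    have hv := (cnl_isHermitian G).mulVec_eigenvectorBasis i
    rw [← hx] at hv
    set v := (cnl_isHermitian G).eigenvectorBasis i with hvd
    have hv0 : v ≠ 0 := (cnl_isHermitian G).eigenvectorBasis.orthonormal.ne_zero i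
    have h1 : (cnl G * cnl G) *ᵥ v.ofLp = (x * x) • v.ofLp := by
      rw [← Matrix.mulVec_mulVec, hv, Matrix.mulVec_smul, hv, smul_smul]
    have h2 : (cnl G * cnl G) *ᵥ v.ofLp = (c * x) • v.ofLp := by
      rw [hc, Matrix.smul_mulVec, hv, smul_smul]
    have h3 : x * x = c * x := by
      have hw : v.ofLp ≠ 0 := by
        intro h; apply hv0; ext j; simpa using congrFun h j
      exact smul_left_injective ℝ hw (h1.symm.trans h2)
    have h4 : x = 0 ∨ x = c := by
      rcases eq_or_ne x 0 with h | h
      · exact Or.inl h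
      · exact Or.inr (mul_right_cancel₀ h h3)
    rcases h4 with h | h
    · rw [h]; simp [abs_of_nonneg ha0]
    · rw [h, abs_of_nonneg (by linarith)]
      rcases eq_or_ne c 0 with h0 | h0
      · subst h0; simp; linarith
      · field_simp; ring
  rw [LEcn, ha, Finset.sum_congr rfl (fun i _ => key i), Finset.sum_add_distrib, ← Finset.sum_mul, ← ht]
  simp

lemma cn_top (N : ℕ) (hN : 2 ≤ N) (i j : Fin N) :
    cn (⊤ : SimpleGraph (Fin N)) i j = ((N : ℝ) - 2) * (1 - if i = j then 1 else 0) := by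
  simp only [cn, Matrix.of_apply]
  split_ifs with h
  · simp
  · rw [Nat.card_eq_fintype_card, SimpleGraph.card_commonNeighbors_top h]
    simp [Nat.cast_sub hN]

lemma cnl_top (N : ℕ) (hN : 2 ≤ N) (i j : Fin N) :
    cnl (⊤ : SimpleGraph (Fin N)) i j = ((N : ℝ) - 2) * ((if i = j then (N : ℝ) else 0) - 1) := by
  simp only [cnl, cnrs, Matrix.sub_apply, Matrix.diagonal_apply, cn_top N hN, ← Finset.mul_sum,
    Finset.sum_sub_distrib]
  split_ifs with h <;> simp <;> ring

lemma LE_top (N : ℕ) (hN : 2 ≤ N) :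
    LEcn (⊤ : SimpleGraph (Fin N)) = 2 * ((N : ℝ) - 1) * (N - 2) := by
  have hN' : (2 : ℝ) ≤ N := by exact_mod_cast hN
  have ht : (cnrs (⊤ : SimpleGraph (Fin N))).trace = N * (((N : ℝ) - 1) * (N - 2)) := by
    simp only [cnrs, Matrix.trace_diagonal, cn_top N hN, ← Finset.mul_sum,
      Finset.sum_sub_distrib]
    simp; ring
  rw [LE_aux _ ((N : ℝ) * (N - 2)) (((N : ℝ) - 1) * (N - 2)), ht]
  · rcases eq_or_ne (N : ℝ) 2 with h | h
    · rw [h]; simp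
    · have : (N : ℝ) - 2 ≠ 0 := sub_ne_zero.2 h
      have : (N : ℝ) ≠ 0 := by linarith
      simp only [Fintype.card_fin]
      field_simp; ring
  · ext i j
    simp only [Matrix.mul_apply, Matrix.smul_apply, cnl_top N hN, smul_eq_mul]
    have : ∀ k, ((N : ℝ) - 2) * ((if i = k then (N : ℝ) else 0) - 1) * (((N : ℝ) - 2) * ((if k = j then (N : ℝ) else 0) - 1))
      = ((N : ℝ) - 2)^2 * ((if i = k then (N:ℝ) * (if k = j then (N : ℝ) else 0) else 0) - (if i = k then (N : ℝ) else 0) - (if k = j then (N : ℝ) else 0) + 1) := by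
      intro k; split_ifs <;> ring
    simp only [this, ← Finset.mul_sum, Finset.sum_add_distrib, Finset.sum_sub_distrib]
    simp
    split_ifs <;> ring
  · apply mul_nonneg <;> linarith
  · nlinarith
  · rw [ht]; simp only [Fintype.card_fin]; field_simp

lemma cn_bip (m n : ℕ) : cn (completeBipartiteGraph (Fin m) (Fin n)) =
    Matrix.fromBlocks (Matrix.of fun i j => (n : ℝ) * (1 - if i = j then 1 else 0)) 0 0
      (Matrix.of fun i j => (m : ℝ) * (1 - if i = j then 1 else 0)) := by
  have hl : ∀ i j : Fin m, (completeBipartiteGraph (Fin m) (Fin n)).commonNeighbors (Sum.inl i) (Sum.inl j) = Set.range Sum.inr := by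
    intro i j; ext x; cases x <;> simp [SimpleGraph.mem_commonNeighbors]
  have hr : ∀ i j : Fin n, (completeBipartiteGraph (Fin m) (Fin n)).commonNeighbors (Sum.inr i) (Sum.inr j) = Set.range Sum.inl := by
    intro i j; ext x; cases x <;> simp [SimpleGraph.mem_commonNeighbors]
  have hlr : ∀ (i : Fin m) (j : Fin n), (completeBipartiteGraph (Fin m) (Fin n)).commonNeighbors (Sum.inl i) (Sum.inr j) = ∅ := by
    intro i j; ext x; cases x <;> simp [SimpleGraph.mem_commonNeighbors]
  have hrl : ∀ (i : Fin n) (j : Fin m), (completeBipartiteGraph (Fin m) (Fin n)).commonNeighbors (Sum.inr i) (Sum.inl j) = ∅ := by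
    intro i j; ext x; cases x <;> simp [SimpleGraph.mem_commonNeighbors]
  ext i j
  rcases i with i | i <;> rcases j with j | j <;> simp only [cn, Matrix.of_apply, hl, hr, hlr, hrl,
    Matrix.fromBlocks_apply₁₁, Matrix.fromBlocks_apply₁₂, Matrix.fromBlocks_apply₂₁, Matrix.fromBlocks_apply₂₂]
  · rw [Nat.card_range_of_injective Sum.inr_injective]
    by_cases h : i = j <;> simp [h]
  · simp
  · simp
  · rw [Nat.card_range_of_injective Sum.inl_injective]
    by_cases h : i = j <;> simp [h]

lemma cnl_bip (m n : ℕ) : cnl (completeBipartiteGraph (Fin m) (Fin n)) =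
    Matrix.fromBlocks (Matrix.of fun i j => (n : ℝ) * ((if i = j then (m : ℝ) else 0) - 1)) 0 0
      (Matrix.of fun i j => (m : ℝ) * ((if i = j then (n : ℝ) else 0) - 1)) := by
  ext i j
  simp only [cnl, cnrs, Matrix.sub_apply, Matrix.diagonal_apply, cn_bip, Fintype.sum_sum_type]
  rcases i with i | i <;> rcases j with j | j <;> simp [← Finset.mul_sum]
  all_goals split_ifs <;> ring

lemma sq_blk (m : ℕ) (q : ℝ) :
    (Matrix.of fun i j : Fin m => q * ((if i = j then (m : ℝ) else 0) - 1)) *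
    (Matrix.of fun i j : Fin m => q * ((if i = j then (m : ℝ) else 0) - 1)) =
    (q * m) • (Matrix.of fun i j : Fin m => q * ((if i = j then (m : ℝ) else 0) - 1)) := by
  ext i j
  simp only [Matrix.mul_apply, Matrix.smul_apply, Matrix.of_apply, smul_eq_mul]
  have : ∀ k, q * ((if i = k then (m : ℝ) else 0) - 1) * (q * ((if k = j then (m : ℝ) else 0) - 1))
    = q^2 * ((if i = k then (m:ℝ) * (if k = j then (m : ℝ) else 0) else 0) - (if i = k then (m : ℝ) else 0) - (if k = j then (m : ℝ) else 0) + 1) := by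
    intro k; split_ifs <;> ring
  simp only [this, ← Finset.mul_sum, Finset.sum_add_distrib, Finset.sum_sub_distrib]
  simp
  split_ifs <;> ring

lemma LE_bip (m n : ℕ) (hm : 1 ≤ m) (hn : 1 ≤ n) :
    LEcn (completeBipartiteGraph (Fin m) (Fin n)) =
      4 * (m * n : ℝ) * (m + n - 2) / (m + n) := by
  have hm' : (1 : ℝ) ≤ m := by exact_mod_cast hm
  have hn' : (1 : ℝ) ≤ n := by exact_mod_cast hn
  have hmn : (0 : ℝ) < m * n := by positivity
  have hs : (0 : ℝ) < m + n := by positivity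
  have ht : (cnrs (completeBipartiteGraph (Fin m) (Fin n))).trace = m * n * ((m : ℝ) + n - 2) := by
    simp only [cnrs, Matrix.trace_diagonal, cn_bip, Fintype.sum_sum_type]
    simp [← Finset.mul_sum]; ring
  rw [LE_aux _ (m * n : ℝ) (m * n * ((m : ℝ) + n - 2) / (m + n)), ht]
  · simp only [Fintype.card_sum, Fintype.card_fin, Nat.cast_add]
    field_simp; ring
  · rw [cnl_bip, Matrix.fromBlocks_multiply, Matrix.fromBlocks_smul, sq_blk, sq_blk]
    simp [mul_comm]
  · apply div_nonneg (mul_nonneg hmn.le (by linarith)) hs.le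
  · rw [div_le_iff₀ hs]; nlinarith
  · rw [ht]; simp

theorem statement6 (m n : ℕ) (hm : 1 ≤ m) (hn : 1 ≤ n) :
    LEcn (completeBipartiteGraph (Fin m) (Fin n)) ≤ LEcn (⊤ : SimpleGraph (Fin (m + n))) ∧
    (LEcn (completeBipartiteGraph (Fin m) (Fin n)) = LEcn (⊤ : SimpleGraph (Fin (m + n))) ↔
      m = 1 ∧ n = 1) ∧
    ¬ LEcn (⊤ : SimpleGraph (Fin (m + n))) <
        LEcn (completeBipartiteGraph (Fin m) (Fin n)) := by
  have hm' : (1 : ℝ) ≤ m := by exact_mod_cast hm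
  have hn' : (1 : ℝ) ≤ n := by exact_mod_cast hn
  have hs : (0 : ℝ) < m + n := by positivity
  rw [LE_bip m n hm hn, LE_top (m + n) (by omega)]
  push_cast
  have hdiff : 2 * ((m : ℝ) + n - 1) * (m + n - 2) - 4 * (m * n : ℝ) * (m + n - 2) / (m + n)
      = (m + n - 2) * ((m - n) ^ 2 + (m + n) * (m + n - 2)) / (m + n) := by
    field_simp; ring
  have hN : (0 : ℝ) ≤ m + n - 2 := by linarith
  have hnn : 0 ≤ ((m : ℝ) + n - 2) * ((m - n) ^ 2 + (m + n) * (m + n - 2)) / (m + n) := by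
    positivity
  have hle : 4 * (m * n : ℝ) * (m + n - 2) / (m + n) ≤ 2 * ((m : ℝ) + n - 1) * (m + n - 2) := by
    linarith
  refine ⟨hle, ⟨fun h => ?_, ?_⟩, not_lt.2 hle⟩
  · by_contra hne
    have h3 : 3 ≤ m + n := by omega
    have h3' : (3 : ℝ) ≤ m + n := by exact_mod_cast h3
    have hN : (0 : ℝ) < m + n - 2 := by linarith
    have : 0 < ((m : ℝ) + n - 2) * ((m - n) ^ 2 + (m + n) * (m + n - 2)) / (m + n) := by
      positivity
    linarith
  · rintro ⟨rfl, rfl⟩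
    norm_num

end CNE
end

section
/- Let G be a finite simple graph on n vertices with |e(G)| edges, first Zagreb index M1(G), maximum degree Δ and minimum degree δ. Then LE_CN(G) ≥ 2(Δ(δ - 1) - (M1(G) - 2|e(G)|)/n) and LE⁺_CN(G) ≥ 2(Δ(δ - 1) - (M1(G) - 2|e(G)|)/n). -/
set_option linter.unusedSectionVars false

open Matrix BigOperators Finset

namespace CNE

variable {V : Type*} [Fintype V]

lemma energy_aux [DecidableEq V] {A : Matrix V V ℝ} (hA : A.IsHermitian) (c : ℝ)
    (hc : A.trace = (Fintype.card V : ℝ) * c) (i : V) :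
    2 * (A i i - c) ≤ ∑ k, |hA.eigenvalues k - c| := by
  set U : Matrix V V ℝ := (hA.eigenvectorUnitary : Matrix V V ℝ) with hU
  have hUU : U * star U = 1 := Unitary.coe_mul_star_self hA.eigenvectorUnitary
  have h1 : ∑ k, U i k ^ 2 = 1 := by
    have := congrFun (congrFun hUU i) i
    simp only [Matrix.mul_apply, Matrix.star_apply, star_trivial, Matrix.one_apply_eq] at this
    rw [← this]
    exact Finset.sum_congr rfl fun k _ => by ring
  have h2 : A i i = ∑ k, hA.eigenvalues k * U i k ^ 2 := by
    have hs : A = U * Matrix.diagonal hA.eigenvalues * star U := by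
      have := hA.spectral_theorem
      rw [Unitary.conjStarAlgAut_apply] at this
      exact this
    have := congrFun (congrFun hs i) i
    rw [this, Matrix.mul_apply]
    refine Finset.sum_congr rfl fun k _ => ?_
    rw [Matrix.mul_diagonal, Matrix.star_apply, star_trivial]
    ring
  have h3 : ∑ k, (hA.eigenvalues k - c) = 0 := by
    have := hA.trace_eq_sum_eigenvalues
    simp only [RCLike.ofReal_real_eq_id, id] at this
    rw [Finset.sum_sub_distrib, ← this, hc]
    simp
  have h4 : A i i - c = ∑ k, (hA.eigenvalues k - c) * U i k ^ 2 := by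
    simp only [sub_mul, Finset.sum_sub_distrib, ← Finset.mul_sum, h1, ← h2, mul_one]
  have h5 : ∑ k, |hA.eigenvalues k - c| =
      ∑ k, (|hA.eigenvalues k - c| + (hA.eigenvalues k - c)) := by
    rw [Finset.sum_add_distrib, h3, add_zero]
  rw [h4, h5, Finset.mul_sum]
  refine Finset.sum_le_sum fun k _ => ?_
  have hw0 : 0 ≤ U i k ^ 2 := sq_nonneg _
  have hw1 : U i k ^ 2 ≤ 1 := by
    rw [← h1]
    exact Finset.single_le_sum (f := fun k => U i k ^ 2) (fun k _ => sq_nonneg _)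
      (Finset.mem_univ k)
  rcases abs_cases (hA.eigenvalues k - c) with ⟨h, h'⟩ | ⟨h, h'⟩ <;> rw [h] <;> nlinarith

lemma cn_eq_sum [DecidableEq V] (G : SimpleGraph V) [DecidableRel G.Adj] (i j : V) :
    cn G i j = ∑ k ∈ G.neighborFinset i, if j ∈ (G.neighborFinset k).erase i then (1 : ℝ) else 0 := by
  by_cases h : i = j
  · subst h
    simp [cn]
  · simp only [cn, Matrix.of_apply, if_neg h, Finset.sum_boole]
    rw [Nat.card_eq_fintype_card, ← Set.toFinset_card]
    congr 2
    ext k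
    simp [SimpleGraph.mem_commonNeighbors, Ne.symm h, G.adj_comm]

lemma row_sum [DecidableEq V] (G : SimpleGraph V) [DecidableRel G.Adj] (i : V) :
    ∑ j, cn G i j = ∑ k ∈ G.neighborFinset i, ((G.degree k : ℝ) - 1) := by
  simp only [cn_eq_sum]
  rw [Finset.sum_comm]
  refine Finset.sum_congr rfl fun k hk => ?_
  have hm : i ∈ G.neighborFinset k := by
    simpa [G.adj_comm] using hk
  rw [Finset.sum_boole, Finset.filter_mem_eq_inter, Finset.univ_inter,
    Finset.cast_card_erase_of_mem hm, SimpleGraph.card_neighborFinset_eq_degree]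

lemma trace_cnrs [DecidableEq V] (G : SimpleGraph V) [DecidableRel G.Adj] :
    (cnrs G).trace = (∑ v, (G.degree v : ℝ) ^ 2) - 2 * (G.edgeFinset.card : ℝ) := by
  have he : (2 * (G.edgeFinset.card : ℝ)) = ∑ v, (G.degree v : ℝ) := by
    exact_mod_cast G.sum_degrees_eq_twice_card_edges.symm
  rw [he, cnrs, Matrix.trace_diagonal]
  simp only [row_sum]
  have : ∀ i, ∑ k ∈ G.neighborFinset i, ((G.degree k : ℝ) - 1) =
      ∑ k, if G.Adj k i then ((G.degree k : ℝ) - 1) else 0 := by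
    intro i
    rw [← Finset.sum_filter]
    refine Finset.sum_congr ?_ fun _ _ => rfl
    ext k
    simp [G.adj_comm]
  simp only [this]
  rw [Finset.sum_comm, ← Finset.sum_sub_distrib]
  refine Finset.sum_congr rfl fun k _ => ?_
  rw [← Finset.sum_filter, Finset.sum_const, ← SimpleGraph.neighborFinset_eq_filter,
    SimpleGraph.card_neighborFinset_eq_degree, nsmul_eq_mul]
  ring

lemma cn_diag [DecidableEq V] (G : SimpleGraph V) (i : V) : cn G i i = 0 := by simp [cn]

lemma row_bound [DecidableEq V] (G : SimpleGraph V) [DecidableRel G.Adj] (i : V) :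
    (G.degree i : ℝ) * ((G.minDegree : ℝ) - 1) ≤ cnrs G i i := by
  rw [cnrs, Matrix.diagonal_apply_eq, row_sum, ← SimpleGraph.card_neighborFinset_eq_degree,
    ← nsmul_eq_mul]
  refine Finset.card_nsmul_le_sum _ _ _ fun k _ => ?_
  have : (G.minDegree : ℝ) ≤ G.degree k := by exact_mod_cast G.minDegree_le_degree k
  linarith

theorem statement17 [DecidableEq V] (G : SimpleGraph V) [DecidableRel G.Adj] :
    2 * ((G.maxDegree : ℝ) * ((G.minDegree : ℝ) - 1) -
        ((∑ v, (G.degree v : ℝ) ^ 2) - 2 * (G.edgeFinset.card : ℝ)) / (Fintype.card V : ℝ)) ≤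
      LEcn G ∧
    2 * ((G.maxDegree : ℝ) * ((G.minDegree : ℝ) - 1) -
        ((∑ v, (G.degree v : ℝ) ^ 2) - 2 * (G.edgeFinset.card : ℝ)) / (Fintype.card V : ℝ)) ≤
      LEpcn G := by
  rcases isEmpty_or_nonempty V with hV | hV
  · simp [LEcn, LEpcn]
  · obtain ⟨i, hi⟩ := G.exists_maximal_degree_vertex
    have hb := row_bound G i
    have hn : (Fintype.card V : ℝ) ≠ 0 := by exact_mod_cast Fintype.card_ne_zero
    have h0 : (cn G).trace = 0 := by simp [Matrix.trace, cn_diag]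
    rw [← trace_cnrs, hi]
    constructor
    · have := energy_aux (cnl_isHermitian G) ((cnrs G).trace / (Fintype.card V : ℝ))
        (by rw [mul_div_cancel₀ _ hn, cnl, Matrix.trace_sub, h0, sub_zero]) i
      refine le_trans ?_ this
      rw [cnl, Matrix.sub_apply, cn_diag]
      linarith
    · have := energy_aux (cnsl_isHermitian G) ((cnrs G).trace / (Fintype.card V : ℝ))
        (by rw [mul_div_cancel₀ _ hn, cnsl, Matrix.trace_add, h0, add_zero]) i
      refine le_trans ?_ this
      rw [cnsl, Matrix.add_apply, cn_diag]
      linarith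

end CNE
end
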